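/- Let ν > 0, let θ : ℤ²₀ → ℝ be not identically zero, have finite support and be radially symmetric, and set ε = 2√ν / ‖θ‖_{ℓ²}. Then for every C² function φ : 𝕋² → ℝ and every x ∈ 𝕋², one has (ε²/2) ∑_{k ∈ ℤ²₀} θ_k² Tr[(σ_k(x) ⊗ σ_k(x)) ∇²φ(x)] = ν Δφ(x), where ∇²φ is the Hessian of φ. -/

import Mathlib

open MeasureTheory Real Filter
open scoped Classical

noncomputable section

abbrev T2 : Type := AddCircle (1:ℝ) × AddCircle (1:ℝ)

/-- cos(2π k·x) on the 2D torus. -/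
def tCos (k : ℤ × ℤ) (x : T2) : ℝ := (fourier k.1 x.1 * fourier k.2 x.2).re

/-- sin(2π k·x) on the 2D torus. -/
def tSin (k : ℤ × ℤ) (x : T2) : ℝ := (fourier k.1 x.1 * fourier k.2 x.2).im

/-- The trigonometric basis functions e_k on the torus. -/
def eFun (k : ℤ × ℤ) (x : T2) : ℝ :=
  if k = 0 then 1
  else if 0 < k.1 ∨ (k.1 = 0 ∧ 0 < k.2) then Real.sqrt 2 * tCos k x
  else Real.sqrt 2 * tSin k x

/-- |k| for k ∈ ℤ². -/
def knorm (k : ℤ × ℤ) : ℝ := Real.sqrt ((k.1:ℝ)^2 + (k.2:ℝ)^2)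

/-- k⊥ = (k₂, -k₁). -/
def kperp (k : ℤ × ℤ) : Fin 2 → ℝ := ![(k.2:ℝ), -(k.1:ℝ)]

/-- The divergence-free vector fields σ_k(x) = (k⊥/|k|) e_k(x). -/
def sigmaV (k : ℤ × ℤ) (x : T2) : Fin 2 → ℝ := fun i => kperp k i / knorm k * eFun k x

/-- θ is radially symmetric: θ_k = θ_j whenever |k| = |j|. -/
def Radial (θ : ℤ × ℤ → ℝ) : Prop := ∀ k j : ℤ × ℤ, knorm k = knorm j → θ k = θ j

/-- Projection of the plane onto the torus. -/
def projE (v : EuclideanSpace ℝ (Fin 2)) : T2 := ((v 0 : AddCircle (1:ℝ)), (v 1 : AddCircle (1:ℝ)))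

/-- The Hessian matrix of a function on the plane. -/
def hessM (f : EuclideanSpace ℝ (Fin 2) → ℝ) (v : EuclideanSpace ℝ (Fin 2)) :
    Matrix (Fin 2) (Fin 2) ℝ :=
  fun i j => iteratedFDeriv ℝ 2 f v ![EuclideanSpace.single i 1, EuclideanSpace.single j 1]

/-- Rotation of the lattice by a quarter turn. -/
def latticeRot : ℤ × ℤ ≃ ℤ × ℤ where
  toFun k := (k.2, -k.1)
  invFun k := (-k.2, k.1)
  left_inv k := by simp
  right_inv k := by simp

theorem finsum_add_comp_equiv {α : Type*} (e : α ≃ α) {f : α → ℝ}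
    (hf : (Function.support f).Finite) : ∑ᶠ k, (f k + f (e k)) = 2 * ∑ᶠ k, f k := by
  have hfe : (Function.support fun k => f (e k)).Finite :=
    hf.preimage e.injective.injOn
  rw [finsum_add_distrib hf hfe, finsum_comp_equiv e, two_mul]

theorem tCos_sq_add_tSin_sq (k : ℤ × ℤ) (x : T2) : tCos k x ^ 2 + tSin k x ^ 2 = 1 := by
  have h : Complex.normSq (fourier k.1 x.1 * fourier k.2 x.2) = 1 := by
    rw [Complex.normSq_eq_norm_sq, norm_mul, fourier_apply, fourier_apply, Circle.norm_coe,
      Circle.norm_coe]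
    norm_num
  rw [Complex.normSq_apply] at h
  simp only [tCos, tSin]
  linarith

theorem tCos_neg (k : ℤ × ℤ) (x : T2) : tCos (-k) x = tCos k x := by
  simp [tCos]

theorem tSin_neg (k : ℤ × ℤ) (x : T2) : tSin (-k) x = -tSin k x := by
  simp [tSin]
  ring

theorem eFun_sq_add_eFun_neg_sq {k : ℤ × ℤ} (hk : k ≠ 0) (x : T2) :
    eFun k x ^ 2 + eFun (-k) x ^ 2 = 2 := by
  have h2 : Real.sqrt 2 ^ 2 = 2 := Real.sq_sqrt (by norm_num)
  have hcs := tCos_sq_add_tSin_sq k x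
  have hk' : ¬(k.1 = 0 ∧ k.2 = 0) := fun h => hk (Prod.ext h.1 h.2)
  by_cases hpos : 0 < k.1 ∨ (k.1 = 0 ∧ 0 < k.2)
  · have hneg : ¬(0 < (-k).1 ∨ ((-k).1 = 0 ∧ 0 < (-k).2)) := by
      simp only [Prod.fst_neg, Prod.snd_neg]; omega
    rw [eFun, eFun, if_neg hk, if_pos hpos, if_neg (neg_ne_zero.mpr hk), if_neg hneg, tSin_neg]
    linear_combination (tCos k x ^ 2 + tSin k x ^ 2) * h2 + 2 * hcs
  · have hneg : 0 < (-k).1 ∨ ((-k).1 = 0 ∧ 0 < (-k).2) := by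
      simp only [Prod.fst_neg, Prod.snd_neg]; omega
    rw [eFun, eFun, if_neg hk, if_neg hpos, if_neg (neg_ne_zero.mpr hk), if_pos hneg, tCos_neg]
    linear_combination (tCos k x ^ 2 + tSin k x ^ 2) * h2 + 2 * hcs

theorem knorm_neg (k : ℤ × ℤ) : knorm (-k) = knorm k := by simp [knorm]

theorem knorm_latticeRot (k : ℤ × ℤ) : knorm (latticeRot k) = knorm k := by
  simp [knorm, latticeRot, add_comm]

theorem knorm_sq (k : ℤ × ℤ) : knorm k ^ 2 = (k.1 : ℝ) ^ 2 + (k.2 : ℝ) ^ 2 :=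
  Real.sq_sqrt (by positivity)

theorem knorm_ne_zero {k : ℤ × ℤ} (hk : k ≠ 0) : knorm k ≠ 0 := by
  intro h
  have h1 := knorm_sq k
  rw [h] at h1
  have ha : (k.1 : ℝ) = 0 := by nlinarith [sq_nonneg (k.1 : ℝ), sq_nonneg (k.2 : ℝ)]
  have hb : (k.2 : ℝ) = 0 := by nlinarith [sq_nonneg (k.1 : ℝ), sq_nonneg (k.2 : ℝ)]
  exact hk (Prod.ext (by exact_mod_cast ha) (by exact_mod_cast hb))

theorem trace_vecMulVec_sigmaV_mul (k : ℤ × ℤ) (x : T2) (H : Matrix (Fin 2) (Fin 2) ℝ) :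
    Matrix.trace (Matrix.vecMulVec (sigmaV k x) (sigmaV k x) * H) =
      (kperp k ⬝ᵥ H.mulVec (kperp k)) / knorm k ^ 2 * eFun k x ^ 2 := by
  simp [Matrix.trace, Matrix.mul_apply, Matrix.vecMulVec_apply, sigmaV, kperp, Fin.sum_univ_two,
    dotProduct, Matrix.mulVec]
  ring

theorem trace_sigmaV_add_neg {k : ℤ × ℤ} (hk : k ≠ 0) (x : T2) (H : Matrix (Fin 2) (Fin 2) ℝ) :
    Matrix.trace (Matrix.vecMulVec (sigmaV k x) (sigmaV k x) * H) +
      Matrix.trace (Matrix.vecMulVec (sigmaV (-k) x) (sigmaV (-k) x) * H) =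
      2 * ((kperp k ⬝ᵥ H.mulVec (kperp k)) / knorm k ^ 2) := by
  have hperp : kperp (-k) = -kperp k := by
    ext i; fin_cases i <;> simp [kperp]
  rw [trace_vecMulVec_sigmaV_mul, trace_vecMulVec_sigmaV_mul, knorm_neg, hperp,
    Matrix.mulVec_neg, neg_dotProduct_neg, ← mul_add, eFun_sq_add_eFun_neg_sq hk, mul_comm]

theorem kperp_quadratic_add_latticeRot {k : ℤ × ℤ} (hk : k ≠ 0) (H : Matrix (Fin 2) (Fin 2) ℝ) :
    (kperp k ⬝ᵥ H.mulVec (kperp k)) / knorm k ^ 2 +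
      (kperp (latticeRot k) ⬝ᵥ H.mulVec (kperp (latticeRot k))) / knorm (latticeRot k) ^ 2 =
      H.trace := by
  rw [knorm_latticeRot, ← add_div, div_eq_iff (pow_ne_zero 2 (knorm_ne_zero hk)), knorm_sq]
  simp [Matrix.trace, kperp, latticeRot, Fin.sum_univ_two, dotProduct, Matrix.mulVec]
  ring

/-- The covariance `∑ θ_k² σ_k ⊗ σ_k` is `‖θ‖² / 2` times the identity, tested against `H`. -/
theorem finsum_sq_mul_trace_sigmaV {θ : ℤ × ℤ → ℝ} (hfin : (Function.support θ).Finite)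
    (hzero : θ 0 = 0) (hrad : Radial θ) (x : T2) (H : Matrix (Fin 2) (Fin 2) ℝ) :
    2 * ∑ᶠ k : ℤ × ℤ, θ k ^ 2 *
      Matrix.trace (Matrix.vecMulVec (sigmaV k x) (sigmaV k x) * H) =
      (∑ᶠ k : ℤ × ℤ, θ k ^ 2) * H.trace := by
  set F : ℤ × ℤ → ℝ := fun k =>
    θ k ^ 2 * Matrix.trace (Matrix.vecMulVec (sigmaV k x) (sigmaV k x) * H)
  set G : ℤ × ℤ → ℝ := fun k =>
    θ k ^ 2 * ((kperp k ⬝ᵥ H.mulVec (kperp k)) / knorm k ^ 2)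
  have hF : (Function.support F).Finite :=
    hfin.subset fun k hk h => hk (by simp [F, h])
  have hG : (Function.support G).Finite :=
    hfin.subset fun k hk h => hk (by simp [G, h])
  have hFG : ∀ k, F k + F (Equiv.neg _ k) = 2 * G k := by
    intro k
    simp only [F, G, Equiv.neg_apply, hrad (-k) k (knorm_neg k)]
    rcases eq_or_ne k 0 with rfl | hk
    · simp [hzero]
    · linear_combination θ k ^ 2 * trace_sigmaV_add_neg hk x H
  have hGtrace : ∀ k, G k + G (latticeRot k) = θ k ^ 2 * H.trace := by
    intro k
    simp only [G, hrad (latticeRot k) k (knorm_latticeRot k)]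
    rcases eq_or_ne k 0 with rfl | hk
    · simp [hzero]
    · linear_combination θ k ^ 2 * kperp_quadratic_add_latticeRot hk H
  have hsumF := finsum_add_comp_equiv (Equiv.neg _) hF
  have hsumG := finsum_add_comp_equiv latticeRot hG
  simp only [hFG, ← mul_finsum] at hsumF
  simp only [hGtrace, ← finsum_mul] at hsumG
  rw [← hsumF, ← hsumG]

theorem finsum_sq_pos {α : Type*} {θ : α → ℝ} (hne : θ ≠ 0)
    (hfin : (Function.support θ).Finite) : 0 < ∑ᶠ k, θ k ^ 2 := by
  obtain ⟨k, hk⟩ := Function.ne_iff.mp hne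
  exact finsum_pos (fun i => sq_nonneg _) ⟨k, sq_pos_of_ne_zero hk⟩
    (hfin.subset fun k hk h => hk (by simp [h]))

/-- With `ε = 2√ν/‖θ‖_{ℓ²}`, for every C² (periodic) function `φ` and every
point, `(ε²/2) ∑_k θ_k² Tr[(σ_k ⊗ σ_k) ∇²φ] = ν Δφ`, where `Δφ = Tr ∇²φ`. -/
theorem statement4 (ν : ℝ) (hν : 0 < ν) (θ : ℤ × ℤ → ℝ) (hne : θ ≠ 0)
    (hfin : (Function.support θ).Finite) (hzero : θ 0 = 0) (hrad : Radial θ)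
    (ε : ℝ) (hε : ε = 2 * Real.sqrt ν / Real.sqrt (∑ᶠ k : ℤ × ℤ, (θ k) ^ 2))
    (φ : EuclideanSpace ℝ (Fin 2) → ℝ) (hφ : ContDiff ℝ 2 φ)
    (hper : ∀ (v : EuclideanSpace ℝ (Fin 2)) (i : Fin 2), φ (v + EuclideanSpace.single i 1) = φ v)
    (v : EuclideanSpace ℝ (Fin 2)) :
    ε ^ 2 / 2 * ∑ᶠ k : ℤ × ℤ, (θ k) ^ 2 *
        Matrix.trace (Matrix.vecMulVec (sigmaV k (projE v)) (sigmaV k (projE v)) * hessM φ v)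
      = ν * Matrix.trace (hessM φ v) := by
  have hS := finsum_sq_pos hne hfin
  have hsum := finsum_sq_mul_trace_sigmaV hfin hzero hrad (projE v) (hessM φ v)
  have hε2 : ε ^ 2 = 4 * ν / ∑ᶠ k : ℤ × ℤ, (θ k) ^ 2 := by
    rw [hε, div_pow, mul_pow, Real.sq_sqrt hν.le, Real.sq_sqrt hS.le]
    norm_num
  rw [hε2]
  field_simp
  linear_combination 2 * hsum
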